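/- arXiv:2403.19328 — 2 statements merged into one kernel-verified Lean document; each statement's English description precedes it below -/
import Mathlib

section
/- Let μ, ν ∈ ℝ with μ + ν > −1 and μ − ν a nonnegative integer, and define b_{α,ν} = (α+3)(α−ν+3)(α+ν+3)/(α+2) and c_{α,ν} = (α+4)(α−ν+3)(α+ν+3)(α−ν+1)(α+ν+1)/(α+2). If μ − ν is even, then for k = 0, 1: ∫₀^∞ w_{μ,ν}(x) ( x² − 2 b_{μ,ν} x + c_{μ,ν} ) x^k dx = 0; if μ − ν is odd, then for k = 0, 1: ∫₀^∞ w_{μ,ν}(x) ( x² − 2 b_{μ+1,ν} x + c_{μ+1,ν} ) x^k dx = 0. In other words, the monic degree-two orthogonal polynomial for w_{μ,ν} is φ₂(x) = x² − 2 b_{μ,ν} x + c_{μ,ν} when μ − ν is even and φ₂(x) = x² − 2 b_{μ+1,ν} x + c_{μ+1,ν} when μ − ν is odd. -/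
open MeasureTheory Filter Set Polynomial
open scoped Classical

noncomputable section

/-- The Abel limit of `∫₀^∞ g(x) dx` is `L`: for every `s > 0` the integral
`∫₀^∞ e^{-s x} g(x) dx` converges and these integrals tend to `L` as `s → 0⁺`. -/
def HasAbelLimit (g : ℝ → ℂ) (L : ℂ) : Prop :=
  (∀ s : ℝ, 0 < s →
    IntegrableOn (fun x : ℝ => Complex.exp (-(s : ℂ) * (x : ℂ)) * g x) (Set.Ioi 0)) ∧
  Tendsto (fun s : ℝ => ∫ x in Set.Ioi (0:ℝ), Complex.exp (-(s : ℂ) * (x : ℂ)) * g x)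
    (nhdsWithin 0 (Set.Ioi 0)) (nhds L)

/-- Bessel function of the first kind of order `ν`, for `x > 0`, with the convention
`1/Γ(z) = 0` at nonpositive integers `z` (automatic since `Real.Gamma` vanishes there). -/
def besselJ (ν x : ℝ) : ℝ :=
  ∑' k : ℕ, ((-1 : ℝ) ^ k / ((k.factorial : ℝ) * Real.Gamma (ν + k + 1))) *
    (x / 2) ^ (ν + 2 * (k : ℝ))

/-- Modified Bessel function of the second kind of order `ν`, for `x > 0`. -/
def besselK (ν x : ℝ) : ℝ :=
  ∫ t in Set.Ioi (0:ℝ), Real.exp (-x * Real.cosh t) * Real.cosh (ν * t)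

/-- The weight function `w_{μ,ν}` on `(0,∞)`. -/
def weightW (μ ν : ℝ) (x : ℝ) : ℝ :=
  if ∃ m : ℤ, μ - ν = 2 * m then (1/2) * x ^ ((μ - 1)/2) * besselK ν (Real.sqrt x)
  else (1/2) * x ^ (μ/2) * besselK ν (Real.sqrt x)

/-- `0 < x_1 < ⋯ < x_n` together with positive weights `w_1, …, w_n` form an `n`-point
Gaussian quadrature rule for `w_{μ,ν}`. -/
def IsGaussRule (μ ν : ℝ) (n : ℕ) (xs ws : Fin n → ℝ) : Prop :=
  StrictMono xs ∧ (∀ j, 0 < xs j) ∧ (∀ j, 0 < ws j) ∧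
  ∀ p : Polynomial ℝ, p.natDegree ≤ 2 * n - 1 →
    ∑ j, ws j * p.eval (xs j) = ∫ x in Set.Ioi (0:ℝ), weightW μ ν x * p.eval x

/-- `κ = μ` if `μ - ν` is even and `κ = μ + 1` if `μ - ν` is odd. -/
def kappaQ (μ ν : ℕ) : ℝ := if Even (μ - ν) then (μ : ℝ) else (μ : ℝ) + 1

/-- The boundary weights `ŵ_k⁰` of the generalized Gauss–Radau rule. -/
def wHat0 (μ ν : ℕ) {n : ℕ} (xs ws : Fin n → ℝ) (k : ℕ) : ℝ :=
  (1 / (k.factorial : ℝ)) *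
    (2 ^ k * Real.Gamma (((ν : ℝ) + k + 1)/2) / Real.Gamma (((ν : ℝ) - k + 1)/2)
      - (2 / Real.pi) * Real.cos (((k : ℝ) - ν) * Real.pi / 2) *
          ∑ j, ws j * (xs j) ^ (((k : ℝ) - kappaQ μ ν)/2))

/-- The generalized Gauss–Radau rule `(Q_{2n,μ} f)(ω)`. -/
def QRule (μ ν : ℕ) {n : ℕ} (xs ws : Fin n → ℝ) (f : ℂ → ℂ) (ω : ℝ) : ℂ :=
  (1 / (ω : ℂ)) *
    ((∑ k ∈ Finset.range μ, (wHat0 μ ν xs ws k : ℂ) / (ω : ℂ) ^ k * iteratedDeriv k f 0)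
      + ∑ j, ((ws j * (xs j) ^ (-(kappaQ μ ν)/2) / Real.pi : ℝ) : ℂ) *
          (Complex.exp (-(ν : ℂ) * (Real.pi : ℂ) * Complex.I / 2) *
              f (Complex.I * (Real.sqrt (xs j) : ℂ) / (ω : ℂ))
            + Complex.exp ((ν : ℂ) * (Real.pi : ℂ) * Complex.I / 2) *
              f (-Complex.I * (Real.sqrt (xs j) : ℂ) / (ω : ℂ))))

/-- `P` is a monic polynomial of degree `m` orthogonal with respect to `x^μ J_ν(x)`
on `(0,∞)`, all integrals taken in the Abel-limit sense. -/
def MonicOrthoBessel (μ ν : ℝ) (m : ℕ) (P : Polynomial ℂ) : Prop :=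
  P.Monic ∧ P.natDegree = m ∧
  ∀ k < m, HasAbelLimit
    (fun x : ℝ => P.eval (x : ℂ) * ((x ^ ((k : ℝ) + μ) : ℝ) : ℂ) * (besselJ ν x : ℂ)) 0

/-- `φ` is the monic real polynomial of degree `m` orthogonal to all lower powers
with respect to the weight `w_{μ,ν}` on `(0,∞)`. -/
def IsMonicOrthoW (μ ν : ℝ) (m : ℕ) (φ : Polynomial ℝ) : Prop :=
  φ.Monic ∧ φ.natDegree = m ∧
  ∀ k < m, ∫ x in Set.Ioi (0:ℝ), weightW μ ν x * φ.eval x * x ^ k = 0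


lemma cosh_mul_rpow_neg_cosh_le {p ν t : ℝ} (hp : 0 ≤ p) (ht : 0 ≤ t) :
    Real.cosh (ν * t) * Real.cosh t ^ (-p) ≤ 2 ^ p * Real.exp ((|ν| - p) * t) := by
  have h1 : Real.cosh (ν * t) ≤ Real.exp (|ν| * t) := by
    rw [← Real.cosh_abs, abs_mul, abs_of_nonneg ht, Real.cosh_eq]
    have : Real.exp (-(|ν| * t)) ≤ Real.exp (|ν| * t) :=
      Real.exp_le_exp.2 (neg_le_self (by positivity))
    linarith
  have h2 : Real.exp t / 2 ≤ Real.cosh t := by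
    rw [Real.cosh_eq]
    have := Real.exp_pos (-t)
    linarith
  have h3 : Real.cosh t ^ (-p) ≤ 2 ^ p * Real.exp (-p * t) := by
    calc Real.cosh t ^ (-p) ≤ (Real.exp t / 2) ^ (-p) :=
          Real.rpow_le_rpow_of_nonpos (by positivity) h2 (by linarith)
      _ = 2 ^ p * Real.exp (-p * t) := by
          rw [Real.div_rpow (Real.exp_pos t).le zero_le_two, Real.rpow_neg zero_le_two,
            ← Real.exp_mul, div_inv_eq_mul, mul_comm t, mul_comm]
  calc Real.cosh (ν * t) * Real.cosh t ^ (-p)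
      ≤ Real.exp (|ν| * t) * (2 ^ p * Real.exp (-p * t)) :=
        mul_le_mul h1 h3 (Real.rpow_nonneg (Real.cosh_pos t).le _) (Real.exp_pos _).le
    _ = 2 ^ p * Real.exp ((|ν| - p) * t) := by
        rw [show (|ν| - p) * t = |ν| * t + -p * t by ring, Real.exp_add]
        ring

lemma continuous_cosh_mul_rpow_cosh (ν p : ℝ) :
    Continuous fun t : ℝ => Real.cosh (ν * t) * Real.cosh t ^ p :=
  (Real.continuous_cosh.comp (continuous_const.mul continuous_id)).mul
    (Real.continuous_cosh.rpow_const fun t => Or.inl (Real.cosh_pos t).ne')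

lemma integrableOn_cosh_mul_rpow_neg_cosh {p ν : ℝ} (hp : |ν| < p) :
    IntegrableOn (fun t : ℝ => Real.cosh (ν * t) * Real.cosh t ^ (-p)) (Ioi 0) := by
  have hp0 : 0 ≤ p := (abs_nonneg ν).trans hp.le
  refine Integrable.mono'
    ((integrableOn_exp_mul_Ioi (a := |ν| - p) (by linarith) 0).const_mul (2 ^ p))
    (continuous_cosh_mul_rpow_cosh ν (-p)).aestronglyMeasurable ?_
  filter_upwards [ae_restrict_mem measurableSet_Ioi] with t ht
  rw [Real.norm_of_nonneg
    (mul_nonneg (Real.cosh_pos _).le (Real.rpow_nonneg (Real.cosh_pos t).le _))]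
  exact cosh_mul_rpow_neg_cosh_le hp0 (le_of_lt ht)

lemma abs_sinh_le_cosh (x : ℝ) : |Real.sinh x| ≤ Real.cosh x :=
  abs_le_of_sq_le_sq (by rw [Real.sinh_sq]; linarith) (Real.cosh_pos x).le

lemma integral_cosh_mul_rpow_neg_cosh_recurrence {p ν : ℝ} (hp : |ν| < p) :
    p * (p + 1) * ∫ t in Ioi (0:ℝ), Real.cosh (ν * t) * Real.cosh t ^ (-(p + 2)) =
      (p ^ 2 - ν ^ 2) * ∫ t in Ioi (0:ℝ), Real.cosh (ν * t) * Real.cosh t ^ (-p) := by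
  have hp0 : 0 ≤ p := (abs_nonneg ν).trans hp.le
  have hI := integrableOn_cosh_mul_rpow_neg_cosh hp
  have hI2 := integrableOn_cosh_mul_rpow_neg_cosh (p := p + 2) (ν := ν) (by linarith)
  have hpow1 (t : ℝ) : Real.cosh t ^ (-p - 1) = Real.cosh t ^ (-(p + 2)) * Real.cosh t := by
    rw [← Real.rpow_add_one (Real.cosh_pos t).ne']
    ring_nf
  have hpow0 (t : ℝ) : Real.cosh t ^ (-p) = Real.cosh t ^ (-(p + 2)) * Real.cosh t ^ 2 := by
    rw [← Real.rpow_add_natCast (Real.cosh_pos t).ne']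
    congr 1
    push_cast
    ring
  let F : ℝ → ℝ := fun t =>
    Real.cosh (ν * t) * (-p * (Real.sinh t * Real.cosh t ^ (-p - 1))) -
      ν * (Real.sinh (ν * t) * Real.cosh t ^ (-p))
  have hderiv (t : ℝ) : HasDerivAt F
      ((p ^ 2 - ν ^ 2) * (Real.cosh (ν * t) * Real.cosh t ^ (-p)) -
        p * (p + 1) * (Real.cosh (ν * t) * Real.cosh t ^ (-(p + 2)))) t := by
    have hl : HasDerivAt (fun t : ℝ => ν * t) ν t := by
      simpa using (hasDerivAt_id t).const_mul ν
    have hr (q : ℝ) : HasDerivAt (fun t : ℝ => Real.cosh t ^ q)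
        (Real.sinh t * q * Real.cosh t ^ (q - 1)) t :=
      (Real.hasDerivAt_cosh t).rpow_const (Or.inl (Real.cosh_pos t).ne')
    have h := (hl.cosh.mul (((Real.hasDerivAt_sinh t).mul (hr (-p - 1))).const_mul (-p))).sub
      ((hl.sinh.mul (hr (-p))).const_mul ν)
    refine h.congr_deriv ?_
    rw [Pi.mul_apply, show -p - 1 - 1 = -(p + 2) by ring, hpow1, hpow0]
    have hs := Real.sinh_sq t
    linear_combination
      (Real.cosh (ν * t) * p * (p + 1) * Real.cosh t ^ (-(p + 2))) * hs
  have hlim : Tendsto F atTop (nhds 0) := by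
    have hexp : Tendsto (fun t : ℝ => (p + |ν|) * (2 ^ p * Real.exp ((|ν| - p) * t)))
        atTop (nhds 0) := by
      have : Tendsto (fun t : ℝ => Real.exp ((|ν| - p) * t)) atTop (nhds 0) :=
        Real.tendsto_exp_atBot.comp
          (tendsto_id.const_mul_atTop_of_neg (by linarith : |ν| - p < 0))
      simpa using (this.const_mul (2 ^ p)).const_mul (p + |ν|)
    refine squeeze_zero_norm' ?_ hexp
    filter_upwards [eventually_ge_atTop 0] with t ht
    have hc : 0 ≤ Real.cosh t ^ (-p - 1) := Real.rpow_nonneg (Real.cosh_pos t).le _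
    have hc' : 0 ≤ Real.cosh t ^ (-p) := Real.rpow_nonneg (Real.cosh_pos t).le _
    have hb : |Real.sinh t| * Real.cosh t ^ (-p - 1) ≤ Real.cosh t ^ (-p) := by
      refine (mul_le_mul_of_nonneg_right (abs_sinh_le_cosh t) hc).trans_eq ?_
      rw [hpow1, hpow0]
      ring
    calc ‖F t‖ ≤ Real.cosh (ν * t) * (p * (|Real.sinh t| * Real.cosh t ^ (-p - 1))) +
          |ν| * (|Real.sinh (ν * t)| * Real.cosh t ^ (-p)) := by
          refine (norm_sub_le _ _).trans_eq ?_
          simp only [Real.norm_eq_abs, abs_mul, abs_neg, abs_of_nonneg hc, abs_of_nonneg hc',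
            abs_of_nonneg hp0, abs_of_pos (Real.cosh_pos (ν * t))]
      _ ≤ Real.cosh (ν * t) * (p * Real.cosh t ^ (-p)) +
          |ν| * (Real.cosh (ν * t) * Real.cosh t ^ (-p)) := by
          have := abs_sinh_le_cosh (ν * t)
          have := (Real.cosh_pos (ν * t)).le
          gcongr
      _ = (p + |ν|) * (Real.cosh (ν * t) * Real.cosh t ^ (-p)) := by ring
      _ ≤ _ := mul_le_mul_of_nonneg_left (cosh_mul_rpow_neg_cosh_le hp0 ht) (by positivity)
  have h := integral_Ioi_of_hasDerivAt_of_tendsto' (a := 0) (fun t _ => hderiv t)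
    ((hI.const_mul _).sub (hI2.const_mul _)) hlim
  rw [integral_sub (hI.const_mul _) (hI2.const_mul _), integral_const_mul,
    integral_const_mul] at h
  simp only [F, mul_zero, Real.sinh_zero, zero_mul, sub_zero] at h
  linarith

/-- Moments of `K_ν(√x)`, by interchanging the order of integration. -/
lemma integral_rpow_mul_besselK_sqrt {q ν : ℝ} (hq : |ν| < 2 * q + 2) :
    IntegrableOn (fun x : ℝ => x ^ q * besselK ν (Real.sqrt x)) (Ioi 0) ∧
      ∫ x in Ioi (0:ℝ), x ^ q * besselK ν (Real.sqrt x) =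
        2 * Real.Gamma (2 * q + 2) *
          ∫ t in Ioi (0:ℝ), Real.cosh (ν * t) * Real.cosh t ^ (-(2 * q + 2)) := by
  have hq1 : -1 < q := by
    have := abs_nonneg ν
    linarith
  let f : ℝ → ℝ → ℝ := fun x t =>
    x ^ q * (Real.exp (-Real.sqrt x * Real.cosh t) * Real.cosh (ν * t))
  have hf (t x : ℝ) : f x t =
      x ^ q * Real.exp (-Real.cosh t * x ^ (1 / 2 : ℝ)) * Real.cosh (ν * t) := by
    simp only [f, Real.sqrt_eq_rpow]
    ring_nf
  have hint (t : ℝ) : IntegrableOn (fun x => f x t) (Ioi 0) := by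
    simp only [hf]
    exact (integrableOn_rpow_mul_exp_neg_mul_rpow hq1 (by norm_num)
      (Real.cosh_pos t)).mul_const _
  have hval (t : ℝ) : ∫ x in Ioi (0:ℝ), f x t = 2 * Real.Gamma (2 * q + 2) *
      (Real.cosh (ν * t) * Real.cosh t ^ (-(2 * q + 2))) := by
    simp only [hf]
    rw [integral_mul_const, integral_rpow_mul_exp_neg_mul_rpow (by norm_num) hq1
      (Real.cosh_pos t), show -(q + 1) / (1 / 2 : ℝ) = -(2 * q + 2) by ring,
      show (q + 1) / (1 / 2 : ℝ) = 2 * q + 2 by ring]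
    ring
  have hnorm (t : ℝ) : ∫ x in Ioi (0:ℝ), ‖f x t‖ = ∫ x in Ioi (0:ℝ), f x t := by
    refine setIntegral_congr_fun measurableSet_Ioi fun x hx => Real.norm_of_nonneg ?_
    have := Real.cosh_pos (ν * t)
    have : 0 ≤ x := le_of_lt hx
    positivity
  have hmeas : Measurable (Function.uncurry f) := by
    have h1 : Measurable Real.cosh := Real.continuous_cosh.measurable
    simp only [f, Function.uncurry_def]
    fun_prop
  have hprod : Integrable (Function.uncurry f)
      ((volume.restrict (Ioi 0)).prod (volume.restrict (Ioi 0))) := by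
    refine (integrable_prod_iff' hmeas.aestronglyMeasurable).2
      ⟨Eventually.of_forall hint, ?_⟩
    simp only [Function.uncurry_apply_pair, hnorm, hval]
    exact (integrableOn_cosh_mul_rpow_neg_cosh hq).const_mul _
  have hK (x : ℝ) : x ^ q * besselK ν (Real.sqrt x) = ∫ t in Ioi (0:ℝ), f x t := by
    simp only [f, besselK, integral_const_mul]
  constructor
  · simp only [hK]
    exact hprod.integral_prod_left
  · simp only [hK]
    rw [integral_integral_swap hprod]
    simp only [hval, integral_const_mul]

lemma integral_rpow_add_one_mul_besselK_sqrt {q ν : ℝ} (hq : |ν| < 2 * q + 2) :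
    ∫ x in Ioi (0:ℝ), x ^ (q + 1) * besselK ν (Real.sqrt x) =
      ((2 * q + 2) ^ 2 - ν ^ 2) * ∫ x in Ioi (0:ℝ), x ^ q * besselK ν (Real.sqrt x) := by
  have hpos : 0 < 2 * q + 2 := (abs_nonneg ν).trans_lt hq
  rw [(integral_rpow_mul_besselK_sqrt hq).2,
    (integral_rpow_mul_besselK_sqrt (q := q + 1) (ν := ν) (by linarith)).2,
    show 2 * (q + 1) + 2 = (2 * q + 2) + 1 + 1 by ring,
    Real.Gamma_add_one (by linarith), Real.Gamma_add_one (by linarith),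
    show 2 * q + 2 + 1 + 1 = (2 * q + 2) + 2 by ring]
  linear_combination 2 * Real.Gamma (2 * q + 2) *
    integral_cosh_mul_rpow_neg_cosh_recurrence hq

/-- The integral of `x ^ q K_ν(√x)` against a quadratic, in terms of the lowest moment. -/
lemma integral_rpow_mul_besselK_sqrt_mul_quadratic {q ν : ℝ} (hq : |ν| < 2 * q + 2)
    (b c : ℝ) :
    ∫ x in Ioi (0:ℝ), x ^ q * besselK ν (Real.sqrt x) * (x ^ 2 - 2 * b * x + c) =
      (((2 * q + 4) ^ 2 - ν ^ 2) * ((2 * q + 2) ^ 2 - ν ^ 2) -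
        2 * b * ((2 * q + 2) ^ 2 - ν ^ 2) + c) *
        ∫ x in Ioi (0:ℝ), x ^ q * besselK ν (Real.sqrt x) := by
  have hq1 : |ν| < 2 * (q + 1) + 2 := by linarith
  have hI0 := (integral_rpow_mul_besselK_sqrt hq).1
  have hI1 := (integral_rpow_mul_besselK_sqrt hq1).1
  have hI2 := (integral_rpow_mul_besselK_sqrt (q := q + 1 + 1) (ν := ν) (by linarith)).1
  have hI21 : IntegrableOn (fun x : ℝ => x ^ (q + 1 + 1) * besselK ν (Real.sqrt x) -
      2 * b * (x ^ (q + 1) * besselK ν (Real.sqrt x))) (Ioi 0) :=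
    hI2.sub (hI1.const_mul _)
  have hexpand : ∫ x in Ioi (0:ℝ),
        x ^ q * besselK ν (Real.sqrt x) * (x ^ 2 - 2 * b * x + c) =
      ∫ x in Ioi (0:ℝ), (x ^ (q + 1 + 1) * besselK ν (Real.sqrt x) -
        2 * b * (x ^ (q + 1) * besselK ν (Real.sqrt x)) +
        c * (x ^ q * besselK ν (Real.sqrt x))) := by
    refine setIntegral_congr_fun measurableSet_Ioi fun x hx => ?_
    have hx0 : x ≠ 0 := ne_of_gt hx
    simp only [Real.rpow_add_one hx0]
    ring
  rw [hexpand, integral_add hI21 (hI0.const_mul _),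
    integral_sub hI2 (hI1.const_mul _), integral_const_mul, integral_const_mul,
    integral_rpow_add_one_mul_besselK_sqrt hq1, integral_rpow_add_one_mul_besselK_sqrt hq]
  ring

lemma integral_rpow_mul_besselK_sqrt_mul_phi_two {α ν : ℝ} (hα : |ν| < α + 1) {k : ℕ}
    (hk : k ≤ 1) :
    ∫ x in Ioi (0:ℝ), (1/2) * x ^ ((α - 1)/2) * besselK ν (Real.sqrt x) *
      (x^2 - 2 * ((α + 3) * (α - ν + 3) * (α + ν + 3) / (α + 2)) * x
        + (α + 4) * (α - ν + 3) * (α + ν + 3) * (α - ν + 1) * (α + ν + 1) / (α + 2)) *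
      x ^ k = 0 := by
  have hα2 : α + 2 ≠ 0 := by
    have := abs_nonneg ν
    linarith
  set b := (α + 3) * (α - ν + 3) * (α + ν + 3) / (α + 2) with hb
  set c := (α + 4) * (α - ν + 3) * (α + ν + 3) * (α - ν + 1) * (α + ν + 1) / (α + 2) with hc
  have hshift : ∫ x in Ioi (0:ℝ), (1/2) * x ^ ((α - 1)/2) * besselK ν (Real.sqrt x) *
        (x^2 - 2 * b * x + c) * x ^ k =
      ∫ x in Ioi (0:ℝ), (1/2) * (x ^ ((α - 1)/2 + k) * besselK ν (Real.sqrt x) *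
        (x^2 - 2 * b * x + c)) := by
    refine setIntegral_congr_fun measurableSet_Ioi fun x hx => ?_
    simp only [Real.rpow_add_natCast (ne_of_gt hx)]
    ring
  have hk0 : (0 : ℝ) ≤ k := k.cast_nonneg
  rw [hshift, integral_const_mul,
    integral_rpow_mul_besselK_sqrt_mul_quadratic (by linarith), ← mul_assoc]
  refine mul_eq_zero_of_left (mul_eq_zero_of_right _ ?_) _
  rw [hb, hc]
  interval_cases k <;> field_simp <;> push_cast <;> ring

/-- the monic degree-two orthogonal polynomial for `w_{μ,ν}`,
with `b_{α,ν} = (α+3)(α−ν+3)(α+ν+3)/(α+2)` and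
`c_{α,ν} = (α+4)(α−ν+3)(α+ν+3)(α−ν+1)(α+ν+1)/(α+2)`. -/
theorem phi_two_weightW (μ ν : ℝ) (h1 : -1 < μ + ν) (hint : ∃ m : ℕ, μ - ν = m) :
    ((∃ m : ℕ, μ - ν = 2 * m) → ∀ k : ℕ, k ≤ 1 →
      ∫ x in Set.Ioi (0:ℝ), weightW μ ν x *
        (x^2 - 2 * ((μ + 3) * (μ - ν + 3) * (μ + ν + 3) / (μ + 2)) * x
          + (μ + 4) * (μ - ν + 3) * (μ + ν + 3) * (μ - ν + 1) * (μ + ν + 1) / (μ + 2)) *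
        x ^ k = 0) ∧
    ((∃ m : ℕ, μ - ν = 2 * m + 1) → ∀ k : ℕ, k ≤ 1 →
      ∫ x in Set.Ioi (0:ℝ), weightW μ ν x *
        (x^2 - 2 * (((μ+1) + 3) * ((μ+1) - ν + 3) * ((μ+1) + ν + 3) / ((μ+1) + 2)) * x
          + ((μ+1) + 4) * ((μ+1) - ν + 3) * ((μ+1) + ν + 3) * ((μ+1) - ν + 1) *
              ((μ+1) + ν + 1) / ((μ+1) + 2)) *
        x ^ k = 0) := by
  obtain ⟨n, hn⟩ := hint
  have hn0 : (0 : ℝ) ≤ n := n.cast_nonneg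
  refine ⟨?_, ?_⟩
  · rintro ⟨m, hm⟩ k hk
    have hw (x : ℝ) : weightW μ ν x =
        (1/2) * x ^ ((μ - 1)/2) * besselK ν (Real.sqrt x) :=
      if_pos ⟨m, by exact_mod_cast hm⟩
    simp only [hw]
    exact integral_rpow_mul_besselK_sqrt_mul_phi_two
      (abs_lt.2 ⟨by linarith, by linarith⟩) hk
  · rintro ⟨m, hm⟩ k hk
    have hodd : ¬ ∃ j : ℤ, μ - ν = 2 * j := by
      rintro ⟨j, hj⟩
      have : (2 * (m : ℤ) + 1 : ℤ) = 2 * j := by exact_mod_cast hm.symm.trans hj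
      omega
    have hw (x : ℝ) : weightW μ ν x =
        (1/2) * x ^ ((μ + 1 - 1)/2) * besselK ν (Real.sqrt x) := by
      rw [weightW, if_neg hodd, add_sub_cancel_right]
    simp only [hw]
    exact integral_rpow_mul_besselK_sqrt_mul_phi_two
      (abs_lt.2 ⟨by linarith, by linarith⟩) hk

end
end

section
/- Let μ, ν ∈ ℝ with μ + ν > −1 and μ − ν an even nonnegative integer. Then for every polynomial Ψ ∈ ℂ[x], the Abel limit of ∫₀^∞ Ψ(x) x^μ J_ν(x) dx exists and equals (e^{i(μ−ν)π/2}/π) ∫₀^∞ ( Ψ(i√x) + Ψ(−i√x) ) w_{μ,ν}(x) dx. -/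
open MeasureTheory Filter Set Polynomial
open scoped Classical

noncomputable section

/-- Coefficients of the regularized hypergeometric series `₀F₁(; ν + 1; z)`. -/
def hypCoeff (ν : ℝ) (k : ℕ) : ℝ := ((k.factorial : ℝ) * Real.Gamma (ν + k + 1))⁻¹

/-- The regularized confluent hypergeometric function `₀F₁(; ν + 1; z) / Γ(ν + 1)`. -/
def hypF (ν z : ℝ) : ℝ := ∑' k : ℕ, hypCoeff ν k * z ^ k

lemma summable_hypCoeff (ν z : ℝ) : Summable fun k : ℕ => hypCoeff ν k * z ^ k := by
  refine Summable.of_norm_bounded_eventually_nat (Real.summable_pow_div_factorial |z|) ?_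
  obtain ⟨N, hN⟩ := exists_nat_ge (1 - ν)
  filter_upwards [eventually_ge_atTop N] with k hk
  have hk' : (N : ℝ) ≤ k := by exact_mod_cast hk
  have hG : 1 ≤ Real.Gamma (ν + k + 1) := by
    have h2 : 2 ≤ ν + k + 1 := by linarith
    exact Real.Gamma_two.symm.trans_le
      (Real.Gamma_strictMonoOn_Ici.monotoneOn self_mem_Ici h2 h2)
  have hf : (0 : ℝ) < k.factorial := by positivity
  rw [hypCoeff, norm_mul, norm_pow, norm_inv, Real.norm_eq_abs, Real.norm_eq_abs,
    abs_of_pos (by positivity), div_eq_inv_mul]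
  gcongr
  exact le_mul_of_one_le_right hf.le hG

lemma succ_mul_hypCoeff_succ (ν : ℝ) (k : ℕ) :
    ((k + 1 : ℕ) : ℝ) * hypCoeff ν (k + 1) = hypCoeff (ν + 1) k := by
  unfold hypCoeff
  rw [Nat.factorial_succ, show ν + ((k + 1 : ℕ) : ℝ) + 1 = ν + 1 + k + 1 by push_cast; ring]
  have : ((k + 1 : ℕ) : ℝ) ≠ 0 := by positivity
  push_cast at *
  rw [mul_assoc, mul_inv ((k : ℝ) + 1), mul_inv_cancel_left₀ this]

lemma inv_Gamma_eq (s : ℝ) : (Real.Gamma s)⁻¹ = s * (Real.Gamma (s + 1))⁻¹ := by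
  rcases eq_or_ne s 0 with rfl | h
  · simp [Real.Gamma_zero]
  · rw [Real.Gamma_add_one h, mul_inv, mul_inv_cancel_left₀ h]

lemma hypCoeff_eq (ν : ℝ) (k : ℕ) :
    hypCoeff ν k = (ν + 1 + k) * hypCoeff (ν + 1) k := by
  unfold hypCoeff
  rw [mul_inv, mul_inv, inv_Gamma_eq, show ν + k + 1 + 1 = ν + 1 + k + 1 by ring]
  ring

lemma hasDerivAt_hypF (ν z : ℝ) : HasDerivAt (hypF ν) (hypF (ν + 1) z) z := by
  set R := |z| + 1 with hR
  have hsum : Summable fun k : ℕ => |hypCoeff ν k * (k * R ^ (k - 1))| := by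
    rw [← summable_nat_add_iff 1]
    refine ((summable_hypCoeff (ν + 1) R).abs).congr fun k => ?_
    rw [← succ_mul_hypCoeff_succ, Nat.add_sub_cancel]
    congr 1
    ring
  have key := hasDerivAt_tsum_of_isPreconnected (t := Metric.ball (0 : ℝ) R)
    (g := fun (k : ℕ) y => hypCoeff ν k * y ^ k)
    (g' := fun (k : ℕ) y => hypCoeff ν k * (k * y ^ (k - 1))) (y₀ := 0) (y := z)
    hsum Metric.isOpen_ball (convex_ball _ _).isPreconnected
    (fun k y _ => (hasDerivAt_pow k y).const_mul _) ?_ (by simp [hR]; positivity)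
    (summable_hypCoeff ν 0) (by simp [hR])
  · refine key.congr_deriv ?_
    have hs : Summable fun k : ℕ => hypCoeff ν k * (k * z ^ (k - 1)) := by
      rw [← summable_nat_add_iff 1]
      refine (summable_hypCoeff (ν + 1) z).congr fun k => ?_
      rw [← succ_mul_hypCoeff_succ, Nat.add_sub_cancel]
      ring
    rw [hs.tsum_eq_zero_add, hypF]
    simp only [Nat.cast_zero, zero_mul, mul_zero, zero_add, Nat.add_sub_cancel]
    refine tsum_congr fun k => ?_
    rw [← succ_mul_hypCoeff_succ]
    ring
  · intro k y hy
    have hy' : |y| ≤ R := by simpa using (mem_ball_zero_iff.mp hy).le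
    rw [Real.norm_eq_abs, abs_mul, abs_mul, abs_mul, abs_mul, abs_pow, abs_pow,
      abs_of_pos (show 0 < R by positivity)]
    gcongr

lemma hypF_eq (ν z : ℝ) : hypF ν z = (ν + 1) * hypF (ν + 1) z + z * hypF (ν + 2) z := by
  have h1 := (summable_hypCoeff (ν + 1) z).mul_left (ν + 1)
  have h2 : Summable fun k : ℕ => k * hypCoeff (ν + 1) k * z ^ k := by
    refine ((summable_hypCoeff ν z).sub h1).congr fun k => ?_
    rw [hypCoeff_eq]; ring
  have h3 : ∑' k : ℕ, k * hypCoeff (ν + 1) k * z ^ k = z * hypF (ν + 2) z := by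
    rw [h2.tsum_eq_zero_add, hypF, ← tsum_mul_left]
    simp only [Nat.cast_zero, zero_mul, zero_add]
    refine tsum_congr fun k => ?_
    rw [succ_mul_hypCoeff_succ, show ν + 1 + 1 = ν + 2 by ring]
    ring
  rw [← h3]
  unfold hypF
  rw [← tsum_mul_left, ← h1.tsum_add h2]
  refine tsum_congr fun k => ?_
  rw [hypCoeff_eq]
  ring

/-- The entire even function `x ↦ x ^ (-ν) * J_ν(x)`. -/
def besselPhi (ν x : ℝ) : ℝ := 2 ^ (-ν) * hypF ν (-(x / 2) ^ 2)

lemma hasDerivAt_besselPhi (ν x : ℝ) :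
    HasDerivAt (besselPhi ν) (-(x * besselPhi (ν + 1) x)) x := by
  have h1 : HasDerivAt (fun y : ℝ => -(y / 2) ^ 2) (-(x / 2)) x := by
    have := (((hasDerivAt_id x).div_const 2).pow 2).neg
    refine this.congr_deriv ?_
    simp; ring
  refine (((hasDerivAt_hypF ν _).comp x h1).const_mul (2 ^ (-ν))).congr_deriv ?_
  rw [besselPhi, neg_add, Real.rpow_add two_pos, Real.rpow_neg_one]
  ring

@[fun_prop]
lemma continuous_besselPhi (ν : ℝ) : Continuous (besselPhi ν) :=
  continuous_iff_continuousAt.mpr fun x => (hasDerivAt_besselPhi ν x).continuousAt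

lemma besselPhi_eq (ν x : ℝ) :
    besselPhi ν x = (2 * ν + 2) * besselPhi (ν + 1) x - x ^ 2 * besselPhi (ν + 2) x := by
  unfold besselPhi
  rw [hypF_eq, neg_add, neg_add, Real.rpow_add two_pos, Real.rpow_add two_pos, Real.rpow_neg_one,
    Real.rpow_neg two_pos.le 2]
  norm_num
  ring

lemma besselPhi_zero (ν : ℝ) : besselPhi ν 0 = (2 ^ ν * Real.Gamma (ν + 1))⁻¹ := by
  have : hypF ν 0 = (Real.Gamma (ν + 1))⁻¹ := by
    unfold hypF
    rw [tsum_eq_single 0 (fun k hk => by simp [hk])]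
    simp [hypCoeff]
  rw [besselPhi, mul_inv, Real.rpow_neg two_pos.le]
  simp [this]

lemma abs_besselPhi_le {ν x : ℝ} (hν : -(1 / 2) ≤ ν) (hx : 0 ≤ x) :
    |besselPhi ν x| ≤ |besselPhi ν 0| := by
  have hd : ∀ y, HasDerivAt (fun y => besselPhi ν y ^ 2 + (y * besselPhi (ν + 1) y) ^ 2)
      (-(2 * (2 * ν + 1) * y * besselPhi (ν + 1) y ^ 2)) y := by
    intro y
    refine (((hasDerivAt_besselPhi ν y).pow 2).add
      (((hasDerivAt_id y).mul (hasDerivAt_besselPhi (ν + 1) y)).pow 2)).congr_deriv ?_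
    simp only [id, Pi.mul_apply]
    rw [besselPhi_eq ν y, show ν + 1 + 1 = ν + 2 by ring]
    push_cast
    ring
  have hanti : AntitoneOn (fun y => besselPhi ν y ^ 2 + (y * besselPhi (ν + 1) y) ^ 2) (Ici 0) := by
    refine antitoneOn_of_deriv_nonpos (convex_Ici 0)
      (fun y _ => (hd y).continuousAt.continuousWithinAt)
      (fun y _ => (hd y).differentiableAt.differentiableWithinAt) fun y hy => ?_
    rw [interior_Ici, mem_Ioi] at hy
    rw [(hd y).deriv, Left.neg_nonpos_iff]
    have : 0 ≤ 2 * ν + 1 := by linarith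
    positivity
  have := hanti self_mem_Ici hx hx
  simp only [zero_mul, ne_eq, OfNat.ofNat_ne_zero, not_false_eq_true, zero_pow, add_zero] at this
  exact sq_le_sq.mp ((le_add_of_nonneg_right (sq_nonneg _)).trans this)

lemma exists_abs_besselPhi_le (ν : ℝ) :
    ∃ (C : ℝ) (N : ℕ), 0 ≤ C ∧ ∀ x, 0 ≤ x → |besselPhi ν x| ≤ C * (1 + x) ^ N := by
  suffices h : ∀ (n : ℕ) (ν : ℝ), -(1 / 2) ≤ ν + n →
      ∃ (C : ℝ) (N : ℕ), 0 ≤ C ∧ ∀ x, 0 ≤ x → |besselPhi ν x| ≤ C * (1 + x) ^ N by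
    obtain ⟨n, hn⟩ := exists_nat_ge (-(1 / 2) - ν)
    exact h n ν (by linarith)
  intro n
  induction n with
  | zero =>
    intro ν hν
    exact ⟨|besselPhi ν 0|, 0, abs_nonneg _, fun x hx => by
      simpa using abs_besselPhi_le (by simpa using hν) hx⟩
  | succ n ih =>
    intro ν hν
    push_cast at hν
    obtain ⟨C, N, hC, h⟩ := ih (ν + 1) (by linarith)
    obtain ⟨D, K, hD, h'⟩ := ih (ν + 2) (by linarith)
    refine ⟨|2 * ν + 2| * C + D, N + (K + 2), by positivity, fun x hx => ?_⟩
    have h1x : 1 ≤ 1 + x := by linarith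
    calc |besselPhi ν x|
        ≤ |2 * ν + 2| * |besselPhi (ν + 1) x| + x ^ 2 * |besselPhi (ν + 2) x| := by
          rw [besselPhi_eq ν x]
          refine (abs_sub _ _).trans_eq ?_
          rw [abs_mul, abs_mul, abs_of_nonneg (sq_nonneg x)]
      _ ≤ |2 * ν + 2| * (C * (1 + x) ^ N) + (1 + x) ^ 2 * (D * (1 + x) ^ K) := by
          gcongr
          · exact h x hx
          · linarith
          · exact h' x hx
      _ = |2 * ν + 2| * C * (1 + x) ^ N + D * (1 + x) ^ (K + 2) := by ring
      _ ≤ |2 * ν + 2| * C * (1 + x) ^ (N + (K + 2)) + D * (1 + x) ^ (N + (K + 2)) := by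
          have hN := pow_le_pow_right₀ h1x (show N ≤ N + (K + 2) by omega)
          have hK := pow_le_pow_right₀ h1x (show K + 2 ≤ N + (K + 2) by omega)
          gcongr
      _ = _ := by ring

lemma exists_abs_besselPhi_le_exp (ν : ℝ) {ε : ℝ} (hε : 0 < ε) :
    ∃ C : ℝ, 0 ≤ C ∧ ∀ x, 0 ≤ x → |besselPhi ν x| ≤ C * Real.exp (ε * x) := by
  obtain ⟨C, N, hC, h⟩ := exists_abs_besselPhi_le ν
  refine ⟨C * (N.factorial / ε ^ N * Real.exp ε), by positivity, fun x hx => (h x hx).trans ?_⟩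
  have h1 := Real.pow_div_factorial_le_exp (ε * (1 + x)) (by positivity) N
  rw [mul_assoc, mul_assoc, ← Real.exp_add, show ε + ε * x = ε * (1 + x) by ring]
  gcongr
  rw [mul_pow, div_le_iff₀ (by positivity)] at h1
  rw [div_mul_eq_mul_div, le_div_iff₀ (by positivity)]
  linarith

lemma integrableOn_rpow_mul_exp {a s : ℝ} (ha : -1 < a) (hs : 0 < s) :
    IntegrableOn (fun x : ℝ => x ^ a * Real.exp (-(s * x))) (Ioi 0) := by
  simpa using integrableOn_rpow_mul_exp_neg_mul_rpow ha one_pos hs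

lemma aestronglyMeasurable_rpow_exp_besselPhi (ν a s : ℝ) :
    AEStronglyMeasurable (fun x : ℝ => x ^ a * Real.exp (-(s * x)) * besselPhi ν x)
      (volume.restrict (Ioi 0)) :=
  ((measurable_id.pow_const a).mul (by fun_prop)).mul
    (continuous_besselPhi ν).measurable |>.aestronglyMeasurable

lemma integrableOn_rpow_exp_besselPhi (ν : ℝ) {a s : ℝ} (ha : -1 < a) (hs : 0 < s) :
    IntegrableOn (fun x : ℝ => x ^ a * Real.exp (-(s * x)) * besselPhi ν x) (Ioi 0) := by
  obtain ⟨C, -, h⟩ := exists_abs_besselPhi_le_exp ν (half_pos hs)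
  refine ((integrableOn_rpow_mul_exp ha (half_pos hs)).const_mul C).mono'
    (aestronglyMeasurable_rpow_exp_besselPhi ν a s) ?_
  filter_upwards [ae_restrict_mem measurableSet_Ioi] with x hx
  have hx0 : 0 < x := hx
  rw [norm_mul, Real.norm_of_nonneg (by positivity), Real.norm_eq_abs]
  calc _ ≤ x ^ a * Real.exp (-(s * x)) * (C * Real.exp (s / 2 * x)) := by
        gcongr
        exact h x hx0.le
    _ = C * (x ^ a * (Real.exp (-(s * x)) * Real.exp (s / 2 * x))) := by ring
    _ = _ := by rw [← Real.exp_add]; ring_nf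

/-- The Laplace transform at `s` of `x ↦ x ^ (a - ν) * J_ν(x)`. -/
noncomputable def laplacePhi (ν a s : ℝ) : ℝ :=
  ∫ x in Ioi (0 : ℝ), x ^ a * Real.exp (-(s * x)) * besselPhi ν x

lemma laplacePhi_add_one (ν : ℝ) {a s : ℝ} (ha : 0 < a) (hs : 0 < s) :
    laplacePhi (ν + 1) (a + 1) s = a * laplacePhi ν (a - 1) s - s * laplacePhi ν a s := by
  have i1 := (integrableOn_rpow_exp_besselPhi ν (show -1 < a - 1 by linarith) hs).const_mul a
  have i2 := (integrableOn_rpow_exp_besselPhi ν (show -1 < a by linarith) hs).const_mul s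
  have i3 := integrableOn_rpow_exp_besselPhi (ν + 1) (show -1 < a + 1 by linarith) hs
  have key := integral_Ioi_of_hasDerivAt_of_tendsto (a := 0) (m := 0)
    (f := fun x : ℝ => x ^ a * Real.exp (-(s * x)) * besselPhi ν x)
    (f' := fun x : ℝ => a * (x ^ (a - 1) * Real.exp (-(s * x)) * besselPhi ν x)
      - s * (x ^ a * Real.exp (-(s * x)) * besselPhi ν x)
      - x ^ (a + 1) * Real.exp (-(s * x)) * besselPhi (ν + 1) x) ?_ ?_ ((i1.sub i2).sub i3) ?_
  · have i12 : IntegrableOn (fun x : ℝ => a * (x ^ (a - 1) * Real.exp (-(s * x)) * besselPhi ν x)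
        - s * (x ^ a * Real.exp (-(s * x)) * besselPhi ν x)) (Ioi 0) := i1.sub i2
    rw [integral_sub i12 i3, integral_sub i1 i2, integral_const_mul,
      integral_const_mul, Real.zero_rpow ha.ne'] at key
    unfold laplacePhi
    linarith
  · refine Continuous.continuousWithinAt ?_
    have : Continuous fun x : ℝ => x ^ a := Real.continuous_rpow_const ha.le
    fun_prop
  · intro x hx
    have hx0 : x ≠ 0 := (mem_Ioi.mp hx).ne'
    have he : HasDerivAt (fun x : ℝ => Real.exp (-(s * x))) (Real.exp (-(s * x)) * -s) x := by
      simpa using (((hasDerivAt_id x).const_mul s).neg).exp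
    refine (((Real.hasDerivAt_rpow_const (Or.inl hx0)).mul he).mul
      (hasDerivAt_besselPhi ν x)).congr_deriv ?_
    rw [Real.rpow_add_one hx0]
    simp only [Pi.mul_apply]
    ring
  · obtain ⟨C, -, h⟩ := exists_abs_besselPhi_le_exp ν (half_pos hs)
    have ht : Tendsto (fun x : ℝ => C * (x ^ a * Real.exp (-(s / 2) * x))) atTop (nhds 0) := by
      simpa using (tendsto_rpow_mul_exp_neg_mul_atTop_nhds_zero a (s / 2) (half_pos hs)).const_mul C
    refine squeeze_zero_norm' ?_ ht
    filter_upwards [eventually_gt_atTop 0] with x hx0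
    rw [norm_mul, Real.norm_of_nonneg (by positivity), Real.norm_eq_abs]
    calc _ ≤ x ^ a * Real.exp (-(s * x)) * (C * Real.exp (s / 2 * x)) := by
          gcongr
          exact h x hx0.le
      _ = C * (x ^ a * (Real.exp (-(s * x)) * Real.exp (s / 2 * x))) := by ring
      _ = _ := by rw [← Real.exp_add]; ring_nf

lemma laplacePhi_eq (ν : ℝ) {a s : ℝ} (ha : -1 < a) (hs : 0 < s) :
    laplacePhi ν a s =
      (2 * ν + 1 - a) * laplacePhi (ν + 1) a s + s * laplacePhi (ν + 1) (a + 1) s := by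
  have i1 := (integrableOn_rpow_exp_besselPhi (ν + 1) ha hs).const_mul (2 * ν + 2)
  have i2 := integrableOn_rpow_exp_besselPhi (ν + 2) (show -1 < a + 2 by linarith) hs
  have h1 : laplacePhi ν a s = (2 * ν + 2) * laplacePhi (ν + 1) a s
      - laplacePhi (ν + 2) (a + 2) s := by
    unfold laplacePhi
    rw [← integral_const_mul, ← integral_sub i1 i2]
    refine setIntegral_congr_fun measurableSet_Ioi fun x hx => ?_
    rw [besselPhi_eq ν x, Real.rpow_add hx, Real.rpow_two]
    ring
  have h2 := laplacePhi_add_one (ν + 1) (show 0 < a + 1 by linarith) hs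
  rw [show ν + 1 + 1 = ν + 2 by ring, show a + 1 + 1 = a + 2 by ring, add_sub_cancel_right] at h2
  rw [h1, h2]
  ring

lemma hasDerivAt_laplacePhi (ν : ℝ) {a s : ℝ} (ha : -1 < a) (hs : 0 < s) :
    HasDerivAt (laplacePhi ν a) (-laplacePhi ν (a + 1) s) s := by
  have hi := (integrableOn_rpow_exp_besselPhi ν (show -1 < a + 1 by linarith) (half_pos hs)).norm
  have key := (hasDerivAt_integral_of_dominated_loc_of_deriv_le
    (μ := volume.restrict (Ioi (0 : ℝ)))
    (F := fun (t x : ℝ) => x ^ a * Real.exp (-(t * x)) * besselPhi ν x)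
    (F' := fun (t x : ℝ) => -(x ^ (a + 1) * Real.exp (-(t * x)) * besselPhi ν x))
    (Ioi_mem_nhds (half_lt_self hs))
    (Eventually.of_forall fun t => aestronglyMeasurable_rpow_exp_besselPhi ν a t)
    (integrableOn_rpow_exp_besselPhi ν ha hs)
    (aestronglyMeasurable_rpow_exp_besselPhi ν (a + 1) s).neg ?_ hi ?_).2
  · refine key.congr_deriv ?_
    rw [integral_neg, laplacePhi]
  · filter_upwards [ae_restrict_mem measurableSet_Ioi] with x hx t ht
    have hx0 : 0 < x := hx
    have ht0 : s / 2 < t := ht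
    rw [norm_neg, norm_mul, norm_mul, norm_mul, norm_mul, Real.norm_of_nonneg (Real.exp_pos _).le,
      Real.norm_of_nonneg (Real.exp_pos _).le]
    gcongr
  · filter_upwards [ae_restrict_mem measurableSet_Ioi] with x hx t ht
    have he : HasDerivAt (fun t : ℝ => Real.exp (-(t * x))) (Real.exp (-(t * x)) * -x) t := by
      simpa using (((hasDerivAt_id t).mul_const x).neg).exp
    refine ((he.const_mul (x ^ a)).mul_const (besselPhi ν x)).congr_deriv ?_
    rw [Real.rpow_add_one (mem_Ioi.mp hx).ne']
    ring

lemma tendsto_rpow_mul_laplacePhi_atTop {ν : ℝ} (hν : -(1 / 2) < ν) :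
    Tendsto (fun s : ℝ => s ^ (2 * ν + 1) * laplacePhi ν (2 * ν) s) atTop
      (nhds (Real.Gamma (2 * ν + 1) * besselPhi ν 0)) := by
  have hscale : ∀ s : ℝ, 0 < s → s ^ (2 * ν + 1) * laplacePhi ν (2 * ν) s =
      ∫ x in Ioi (0 : ℝ), x ^ (2 * ν) * Real.exp (-x) * besselPhi ν (s⁻¹ * x) := by
    intro s hs
    have := integral_comp_mul_left_Ioi
      (fun x : ℝ => x ^ (2 * ν) * Real.exp (-x) * besselPhi ν (s⁻¹ * x)) 0 hs
    rw [mul_zero, smul_eq_mul, inv_mul_eq_div, eq_div_iff hs.ne'] at this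
    rw [← this, laplacePhi, Real.rpow_add_one hs.ne', mul_assoc, mul_comm s, ← mul_assoc,
      ← integral_const_mul]
    congr 1
    refine setIntegral_congr_fun measurableSet_Ioi fun x hx => ?_
    rw [inv_mul_cancel_left₀ hs.ne', Real.mul_rpow hs.le (mem_Ioi.mp hx).le]
    ring
  have hlim : Tendsto
      (fun s : ℝ => ∫ x in Ioi (0 : ℝ), x ^ (2 * ν) * Real.exp (-x) * besselPhi ν (s⁻¹ * x)) atTop
      (nhds (∫ x in Ioi (0 : ℝ), x ^ (2 * ν) * Real.exp (-x) * besselPhi ν 0)) := by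
    have hi : IntegrableOn (fun x : ℝ => x ^ (2 * ν) * Real.exp (-x) * |besselPhi ν 0|)
        (Ioi 0) := by
      simpa [IntegrableOn] using
        (integrableOn_rpow_mul_exp (show -1 < 2 * ν by linarith) one_pos).mul_const _
    refine tendsto_integral_filter_of_dominated_convergence _ (Eventually.of_forall fun s => ?_)
      ?_ hi (Eventually.of_forall fun x => ?_)
    · exact (((measurable_id.pow_const _).mul (by fun_prop)).mul
        (by fun_prop)).aestronglyMeasurable
    · filter_upwards [eventually_gt_atTop 0] with s hs
      filter_upwards [ae_restrict_mem measurableSet_Ioi] with x hx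
      have hx0 : 0 < x := hx
      rw [norm_mul, Real.norm_of_nonneg (by positivity), Real.norm_eq_abs]
      gcongr _ * ?_
      exact abs_besselPhi_le hν.le (by positivity)
    · refine (((continuous_besselPhi ν).tendsto 0).comp ?_).const_mul _
      simpa using tendsto_inv_atTop_zero.mul_const x
  have hG : ∫ x in Ioi (0 : ℝ), x ^ (2 * ν) * Real.exp (-x) * besselPhi ν 0 =
      Real.Gamma (2 * ν + 1) * besselPhi ν 0 := by
    rw [integral_mul_const, Real.Gamma_eq_integral (by linarith), add_sub_cancel_right]
    simp only [mul_comm]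
  rw [← hG]
  refine hlim.congr' ?_
  filter_upwards [eventually_gt_atTop 0] with s hs using (hscale s hs).symm

lemma laplacePhi_two_mul {ν s : ℝ} (hν : -(1 / 2) < ν) (hs : 0 < s) :
    laplacePhi ν (2 * ν) s =
      Real.Gamma (2 * ν + 1) * besselPhi ν 0 * (1 + s ^ 2) ^ (-(ν + 1 / 2)) := by
  have hd : ∀ t : ℝ, 0 < t →
      HasDerivAt (fun t => (1 + t ^ 2) ^ (ν + 1 / 2) * laplacePhi ν (2 * ν) t) 0 t := by
    intro t ht
    have h1 := laplacePhi_eq ν (show -1 < 2 * ν + 1 by linarith) ht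
    have h2 := laplacePhi_add_one ν (show 0 < 2 * ν + 1 by linarith) ht
    rw [add_sub_cancel_right] at h2
    have hpos : 0 < 1 + t ^ 2 := by positivity
    have hp : HasDerivAt (fun t : ℝ => 1 + t ^ 2) (2 * t) t := by
      simpa using (hasDerivAt_pow 2 t).const_add 1
    refine ((hp.rpow_const (p := ν + 1 / 2) (Or.inl hpos.ne')).mul
      (hasDerivAt_laplacePhi ν (show -1 < 2 * ν by linarith) ht)).congr_deriv ?_
    rw [show (1 + t ^ 2) ^ (ν + 1 / 2) = (1 + t ^ 2) ^ (ν + 1 / 2 - 1) * (1 + t ^ 2) by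
      rw [← Real.rpow_add_one hpos.ne', sub_add_cancel]]
    linear_combination (1 + t ^ 2) ^ (ν + 1 / 2 - 1) * (-t * h2 - h1)
  have hconst : ∀ t ∈ Ioi (0 : ℝ), (1 + t ^ 2) ^ (ν + 1 / 2) * laplacePhi ν (2 * ν) t =
      (1 + s ^ 2) ^ (ν + 1 / 2) * laplacePhi ν (2 * ν) s := fun t ht =>
    isOpen_Ioi.is_const_of_deriv_eq_zero isPreconnected_Ioi
      (fun u hu => (hd u hu).differentiableAt.differentiableWithinAt)
      (fun u hu => (hd u hu).deriv) ht hs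
  have hratio : Tendsto (fun t : ℝ => ((t⁻¹) ^ 2 + 1) ^ (ν + 1 / 2)) atTop (nhds 1) := by
    have h0 : Tendsto (fun t : ℝ => (t⁻¹) ^ 2 + 1) atTop (nhds 1) := by
      simpa using (tendsto_inv_atTop_zero.pow 2).add_const (1 : ℝ)
    simpa using h0.rpow_const (p := ν + 1 / 2) (Or.inl one_ne_zero)
  have hlim := hratio.mul (tendsto_rpow_mul_laplacePhi_atTop hν)
  have heq : (fun t : ℝ => ((t⁻¹) ^ 2 + 1) ^ (ν + 1 / 2) *
      (t ^ (2 * ν + 1) * laplacePhi ν (2 * ν) t)) =ᶠ[atTop]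
      fun _ => (1 + s ^ 2) ^ (ν + 1 / 2) * laplacePhi ν (2 * ν) s := by
    filter_upwards [eventually_gt_atTop 0] with t ht
    rw [← hconst t ht, ← mul_assoc]
    congr 1
    rw [show 2 * ν + 1 = 2 * (ν + 1 / 2) by ring, Real.rpow_mul ht.le, Real.rpow_two,
      ← Real.mul_rpow (by positivity) (by positivity)]
    congr 1
    field_simp
  have hval := tendsto_nhds_unique (hlim.congr' heq) tendsto_const_nhds
  rw [one_mul] at hval
  have hpos : (1 + s ^ 2) ^ (ν + 1 / 2) ≠ 0 := by positivity
  rw [Real.rpow_neg (by positivity), hval, mul_right_comm, mul_inv_cancel₀ hpos, one_mul]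

lemma tendsto_laplacePhi (p : ℕ) : ∀ ν : ℝ, -1 < 2 * ν + p →
    Tendsto (laplacePhi ν (2 * ν + p)) (nhdsWithin 0 (Ioi 0))
      (nhds (if Even p then (-1) ^ (p / 2) / Real.pi * 2 ^ (ν + p) *
        Real.Gamma (ν + p / 2 + 1 / 2) * Real.Gamma (p / 2 + 1 / 2) else 0)) := by
  induction p using Nat.strong_induction_on with
  | _ p ih =>
  have hs0 : Tendsto (fun s : ℝ => s) (nhdsWithin 0 (Ioi 0)) (nhds 0) :=
    tendsto_id.mono_left nhdsWithin_le_nhds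
  have hrec : ∀ ν : ℝ, -1 < 2 * ν + p → (fun s => (1 - p) * laplacePhi (ν + 1) (2 * ν + p) s
      + s * laplacePhi (ν + 1) (2 * ν + p + 1) s) =ᶠ[nhdsWithin 0 (Ioi 0)]
      laplacePhi ν (2 * ν + p) := fun ν hν => by
    filter_upwards [self_mem_nhdsWithin] with s hs
    rw [laplacePhi_eq ν hν hs]
    ring
  match p, ih, hrec with
  | 0, _, _ =>
    intro ν hν
    simp only [Nat.cast_zero, add_zero] at hν ⊢
    have hν' : -(1 / 2) < ν := by linarith
    have hc : Continuous fun s : ℝ =>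
        Real.Gamma (2 * ν + 1) * besselPhi ν 0 * (1 + s ^ 2) ^ (-(ν + 1 / 2)) :=
      continuous_const.mul (Continuous.rpow_const (by fun_prop) fun s => Or.inl (by positivity))
    have h0 := (hc.tendsto 0).mono_left (nhdsWithin_le_nhds (s := Ioi 0))
    have hval : Real.Gamma (2 * ν + 1) * besselPhi ν 0 * (1 + 0 ^ 2) ^ (-(ν + 1 / 2)) =
        1 / Real.pi * 2 ^ ν * Real.Gamma (ν + 1 / 2) * Real.Gamma (1 / 2) := by
      have hdup := Real.Gamma_mul_Gamma_add_half (ν + 1 / 2)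
      have hg : 0 < Real.Gamma (ν + 1) := Real.Gamma_pos_of_pos (by linarith)
      have h2 : (2 : ℝ) ^ (1 - 2 * (ν + 1 / 2)) = (2 ^ ν * 2 ^ ν)⁻¹ := by
        rw [← Real.rpow_add two_pos, ← Real.rpow_neg two_pos.le]
        congr 1
        ring
      rw [show ν + 1 / 2 + 1 / 2 = ν + 1 by ring, show 2 * (ν + 1 / 2) = 2 * ν + 1 by ring] at hdup
      rw [show 2 * (ν + 1 / 2) = 2 * ν + 1 by ring] at h2
      rw [h2] at hdup
      rw [besselPhi_zero, Real.Gamma_one_half_eq, eq_div_of_mul_eq hg.ne' hdup]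
      have hpi := Real.pi_pos
      simp only [ne_eq, OfNat.ofNat_ne_zero, not_false_eq_true, zero_pow, add_zero, Real.one_rpow]
      field_simp
      rw [Real.sq_sqrt hpi.le]
    rw [hval] at h0
    simp only [Even.zero, ↓reduceIte, Nat.zero_div, pow_zero, zero_div, add_zero, zero_add]
    refine h0.congr' ?_
    filter_upwards [self_mem_nhdsWithin] with s hs
    rw [laplacePhi_two_mul hν' hs]
  | 1, ih, hrec =>
    intro ν hν
    refine Tendsto.congr' (hrec ν hν) ?_
    push_cast at hν ⊢
    have h0 := ih 0 one_pos (ν + 1) (by push_cast; linarith)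
    have := hs0.mul h0
    rw [show 2 * (ν + 1) + ((0 : ℕ) : ℝ) = 2 * ν + 1 + 1 by push_cast; ring] at this
    simpa using this
  | p + 2, ih, hrec =>
    intro ν hν
    refine Tendsto.congr' (hrec ν hν) ?_
    push_cast at hν
    have h0 := ih p (by omega) (ν + 1) (by linarith)
    have h1 := ih (p + 1) (by omega) (ν + 1) (by push_cast; linarith)
    rw [show 2 * (ν + 1) + (p : ℝ) = 2 * ν + ((p + 2 : ℕ) : ℝ) by push_cast; ring] at h0
    rw [show 2 * (ν + 1) + ((p + 1 : ℕ) : ℝ) = 2 * ν + ((p + 2 : ℕ) : ℝ) + 1 by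
      push_cast; ring] at h1
    refine ((h0.const_mul (1 - ((p + 2 : ℕ) : ℝ))).add (hs0.mul h1)).trans_eq ?_
    rcases Nat.even_or_odd p with he | ho
    · have he2 : Even (p + 2) := by simpa [Nat.even_add] using he
      have hne : (p : ℝ) / 2 + 1 / 2 ≠ 0 := by positivity
      rw [if_pos he, if_pos he2, zero_mul, add_zero, Nat.add_div_right p two_pos, pow_succ]
      push_cast
      rw [show ν + ((p : ℝ) + 2) / 2 + 1 / 2 = ν + 1 + p / 2 + 1 / 2 by ring,
        show ((p : ℝ) + 2) / 2 + 1 / 2 = p / 2 + 1 / 2 + 1 by ring, Real.Gamma_add_one hne,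
        show ν + ((p : ℝ) + 2) = ν + 1 + p + 1 by ring, Real.rpow_add_one two_ne_zero]
      congr 1
      ring
    · have ho2 : ¬ Even (p + 2) := by simpa [Nat.even_add] using ho
      rw [if_neg (Nat.not_even_iff_odd.mpr ho), if_neg ho2, mul_zero, zero_mul, add_zero]

lemma integrableOn_beta {a b : ℝ} (ha : 0 < a) (hb : 0 < b) :
    IntegrableOn (fun x : ℝ => x ^ (a - 1) * (1 - x) ^ (b - 1)) (Ioo 0 1) ∧
      ∫ x in Ioo (0 : ℝ) 1, x ^ (a - 1) * (1 - x) ^ (b - 1) =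
        Real.Gamma a * Real.Gamma b / Real.Gamma (a + b) := by
  have hc : IntegrableOn
      (fun x : ℝ => (x : ℂ) ^ ((a : ℂ) - 1) * (1 - (x : ℂ)) ^ ((b : ℂ) - 1)) (Ioo 0 1) := by
    have := Complex.betaIntegral_convergent (u := a) (v := b) (by simpa) (by simpa)
    rwa [intervalIntegrable_iff_integrableOn_Ioo_of_le zero_le_one] at this
  have heq : EqOn (fun x : ℝ => (x : ℂ) ^ ((a : ℂ) - 1) * (1 - (x : ℂ)) ^ ((b : ℂ) - 1))
      (fun x : ℝ => ((x ^ (a - 1) * (1 - x) ^ (b - 1) : ℝ) : ℂ)) (Ioo 0 1) := by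
    rintro x ⟨h0, h1⟩
    simp only
    rw [Complex.ofReal_mul, Complex.ofReal_cpow h0.le, Complex.ofReal_cpow (sub_nonneg.mpr h1.le)]
    push_cast
    rfl
  refine ⟨?_, ?_⟩
  · have := (hc.congr_fun heq measurableSet_Ioo).re
    simpa [IntegrableOn] using this
  · have h1 := Complex.betaIntegral_eq_Gamma_mul_div a b (by simpa) (by simpa)
    rw [Complex.betaIntegral, intervalIntegral.integral_of_le zero_le_one,
      integral_Ioc_eq_integral_Ioo, setIntegral_congr_fun measurableSet_Ioo heq,
      integral_complex_ofReal, ← Complex.ofReal_add, Complex.Gamma_ofReal, Complex.Gamma_ofReal,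
      Complex.Gamma_ofReal] at h1
    exact_mod_cast h1

lemma integrable_exp_mul_cosh_rpow {a b : ℝ} (ha : 0 < a) (hb : 0 < b) :
    Integrable (fun t : ℝ => Real.exp ((a - b) * t) * Real.cosh t ^ (-(a + b))) ∧
      ∫ t : ℝ, Real.exp ((a - b) * t) * Real.cosh t ^ (-(a + b)) =
        2 ^ (a + b - 1) * (Real.Gamma a * Real.Gamma b / Real.Gamma (a + b)) := by
  obtain ⟨hi, hv⟩ := integrableOn_beta ha hb
  set f : ℝ → ℝ := fun t => Real.sigmoid (2 * t) with hf
  have hder : ∀ t ∈ (univ : Set ℝ), HasDerivWithinAt f (f t * (1 - f t) * 2) univ t := by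
    intro t _
    have h2 : HasDerivAt (fun t : ℝ => 2 * t) 2 t := by simpa using (hasDerivAt_id t).const_mul 2
    exact ((Real.hasDerivAt_sigmoid (2 * t)).comp t h2).hasDerivWithinAt
  have hinj : InjOn f univ := fun t _ u _ h => by
    have := Real.sigmoid_injective h
    linarith
  have himg : f '' univ = Ioo 0 1 := by
    rw [image_univ, ← Real.range_sigmoid]
    exact (mul_left_surjective₀ (two_ne_zero' ℝ)).range_comp Real.sigmoid
  have hpt : ∀ t, |f t * (1 - f t) * 2| • (f t ^ (a - 1) * (1 - f t) ^ (b - 1)) =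
      2 ^ (1 - (a + b)) * (Real.exp ((a - b) * t) * Real.cosh t ^ (-(a + b))) := by
    intro t
    have h0 : 0 < f t := Real.sigmoid_pos _
    have h1 : 0 < 1 - f t := sub_pos.mpr (Real.sigmoid_lt_one _)
    have hcosh := Real.cosh_pos t
    have e1 : f t = Real.exp t / (2 * Real.cosh t) := by
      simp only [hf, Real.sigmoid_def]
      rw [Real.cosh_eq, show -(2 * t) = -t + -t by ring, Real.exp_add, Real.exp_neg]
      field_simp
    have e2 : 1 - f t = Real.exp (-t) / (2 * Real.cosh t) := by
      rw [e1, eq_div_iff (by positivity), sub_mul, div_mul_cancel₀ _ (by positivity), Real.cosh_eq]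
      ring
    rw [abs_of_pos (by positivity), smul_eq_mul]
    calc f t * (1 - f t) * 2 * (f t ^ (a - 1) * (1 - f t) ^ (b - 1))
        = 2 * (f t ^ (a - 1) * f t * ((1 - f t) ^ (b - 1) * (1 - f t))) := by ring
      _ = 2 * (f t ^ a * (1 - f t) ^ b) := by
          rw [← Real.rpow_add_one h0.ne', ← Real.rpow_add_one h1.ne', sub_add_cancel,
            sub_add_cancel]
      _ = _ := by
          rw [e2, e1, Real.div_rpow (by positivity) (by positivity),
            Real.div_rpow (by positivity) (by positivity), ← Real.exp_mul, ← Real.exp_mul,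
            show (a - b) * t = t * a + -t * b by ring, Real.exp_add, neg_add,
            Real.rpow_add hcosh, Real.rpow_neg hcosh.le, Real.rpow_neg hcosh.le,
            Real.mul_rpow two_pos.le hcosh.le, Real.mul_rpow two_pos.le hcosh.le,
            Real.rpow_sub two_pos, Real.rpow_add two_pos, Real.rpow_one]
          field_simp
  rw [← himg, integrableOn_image_iff_integrableOn_abs_deriv_smul MeasurableSet.univ hder hinj] at hi
  rw [← himg, integral_image_eq_integral_abs_deriv_smul MeasurableSet.univ hder hinj] at hv
  simp only [hpt] at hi hv
  rw [integrableOn_univ] at hi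
  rw [setIntegral_univ, integral_const_mul] at hv
  have h2 : (2 : ℝ) ^ (a + b - 1) * 2 ^ (1 - (a + b)) = 1 := by
    rw [← Real.rpow_add two_pos]
    simp
  refine ⟨?_, ?_⟩
  · simpa only [← mul_assoc, h2, one_mul] using hi.const_mul (2 ^ (a + b - 1))
  · rw [← hv, ← mul_assoc, h2, one_mul]

lemma integrableOn_cosh_mul_cosh_rpow {a b : ℝ} (ha : 0 < a) (hb : 0 < b) :
    IntegrableOn (fun t : ℝ => Real.cosh ((a - b) * t) * Real.cosh t ^ (-(a + b))) (Ioi 0) ∧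
      ∫ t in Ioi (0 : ℝ), Real.cosh ((a - b) * t) * Real.cosh t ^ (-(a + b)) =
        2 ^ (a + b - 2) * (Real.Gamma a * Real.Gamma b / Real.Gamma (a + b)) := by
  obtain ⟨i1, v1⟩ := integrable_exp_mul_cosh_rpow ha hb
  obtain ⟨i2, v2⟩ := integrable_exp_mul_cosh_rpow hb ha
  rw [add_comm b a] at i2 v2
  have heq : (fun t : ℝ => Real.cosh ((a - b) * t) * Real.cosh t ^ (-(a + b))) =
      fun t : ℝ => (Real.exp ((a - b) * t) * Real.cosh t ^ (-(a + b)) +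
        Real.exp ((b - a) * t) * Real.cosh t ^ (-(a + b))) / 2 := by
    funext t
    rw [Real.cosh_eq ((a - b) * t), show -((a - b) * t) = (b - a) * t by ring]
    ring
  refine ⟨?_, ?_⟩
  · rw [heq]
    exact ((i1.add i2).div_const 2).integrableOn
  · have habs := integral_comp_abs
      (f := fun t : ℝ => Real.cosh ((a - b) * t) * Real.cosh t ^ (-(a + b)))
    have hab : ∀ t : ℝ, Real.cosh ((a - b) * |t|) = Real.cosh ((a - b) * t) := fun t => by
      rw [← Real.cosh_abs ((a - b) * |t|), abs_mul, abs_abs, ← abs_mul, Real.cosh_abs]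
    simp only [Real.cosh_abs, hab] at habs
    rw [heq] at habs ⊢
    rw [integral_div, integral_add i1 i2, v1, v2] at habs
    have h2 : (2 : ℝ) ^ (a + b - 1) = 2 ^ (a + b - 2) * 2 := by
      rw [← Real.rpow_add_one two_ne_zero]
      congr 1
      ring
    rw [h2, mul_comm (Real.Gamma b)] at habs
    linarith

lemma integrableOn_rpow_mul_besselK {l ν : ℝ} (h1 : -1 < l + ν) (h2 : -1 < l - ν) :
    IntegrableOn (fun y : ℝ => y ^ l * besselK ν y) (Ioi 0) ∧
      ∫ y in Ioi (0 : ℝ), y ^ l * besselK ν y =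
        2 ^ (l - 1) * Real.Gamma ((l + ν + 1) / 2) * Real.Gamma ((l - ν + 1) / 2) := by
  have hl : 0 < l + 1 := by linarith
  obtain ⟨hi, hv⟩ := integrableOn_cosh_mul_cosh_rpow
    (show 0 < (l + ν + 1) / 2 by linarith) (show 0 < (l - ν + 1) / 2 by linarith)
  rw [show (l + ν + 1) / 2 - (l - ν + 1) / 2 = ν by ring,
    show (l + ν + 1) / 2 + (l - ν + 1) / 2 = l + 1 by ring] at hi hv
  have hinner : ∀ t : ℝ, ∫ y in Ioi (0 : ℝ),
      y ^ l * (Real.exp (-y * Real.cosh t) * Real.cosh (ν * t)) =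
        Real.Gamma (l + 1) * (Real.cosh (ν * t) * Real.cosh t ^ (-(l + 1))) := by
    intro t
    have := Real.integral_rpow_mul_exp_neg_mul_Ioi hl (Real.cosh_pos t)
    rw [add_sub_cancel_right, one_div, Real.inv_rpow (Real.cosh_pos t).le,
      ← Real.rpow_neg (Real.cosh_pos t).le] at this
    rw [show Real.Gamma (l + 1) * (Real.cosh (ν * t) * Real.cosh t ^ (-(l + 1))) =
      (Real.cosh t ^ (-(l + 1)) * Real.Gamma (l + 1)) * Real.cosh (ν * t) by ring, ← this,
      ← integral_mul_const]
    refine setIntegral_congr_fun measurableSet_Ioi fun y _ => ?_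
    simp only [neg_mul, mul_comm y]
    ring
  have hprod : Integrable
      (fun z : ℝ × ℝ => z.1 ^ l * (Real.exp (-z.1 * Real.cosh z.2) * Real.cosh (ν * z.2)))
      ((volume.restrict (Ioi 0)).prod (volume.restrict (Ioi 0))) := by
    have hm : Measurable
        fun z : ℝ × ℝ => z.1 ^ l * (Real.exp (-z.1 * Real.cosh z.2) * Real.cosh (ν * z.2)) :=
      (measurable_fst.pow_const l).mul (Continuous.measurable (by fun_prop))
    rw [integrable_prod_iff' hm.aestronglyMeasurable]
    refine ⟨Eventually.of_forall fun t => ?_, ?_⟩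
    · have := (integrableOn_rpow_mul_exp (show -1 < l by linarith)
        (Real.cosh_pos t)).mul_const (Real.cosh (ν * t))
      refine this.congr (Eventually.of_forall fun y => ?_)
      simp only [neg_mul, mul_comm y]
      ring
    · refine (hi.const_mul (Real.Gamma (l + 1))).congr (Eventually.of_forall fun t => ?_)
      simp only
      rw [← hinner]
      refine setIntegral_congr_fun measurableSet_Ioi fun y hy => ?_
      have hy0 : 0 < y := hy
      have := Real.cosh_pos (ν * t)
      rw [Real.norm_of_nonneg (by positivity)]
  refine ⟨?_, ?_⟩
  · have := hprod.integral_prod_left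
    simpa only [IntegrableOn, integral_const_mul, besselK] using this
  · have hswap := integral_integral_swap
      (f := fun y t : ℝ => y ^ l * (Real.exp (-y * Real.cosh t) * Real.cosh (ν * t))) hprod
    simp only [integral_const_mul, hinner, hv] at hswap
    have hG : Real.Gamma (l + 1) ≠ 0 := (Real.Gamma_pos_of_pos hl).ne'
    unfold besselK
    rw [hswap, show l + 1 - 2 = l - 1 by ring]
    field_simp

lemma integrableOn_rpow_mul_besselK_sqrt {l ν : ℝ} (h1 : -1 < l + ν) (h2 : -1 < l - ν) :
    IntegrableOn (fun x : ℝ => 1 / 2 * x ^ ((l - 1) / 2) * besselK ν (Real.sqrt x)) (Ioi 0) ∧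
      ∫ x in Ioi (0 : ℝ), 1 / 2 * x ^ ((l - 1) / 2) * besselK ν (Real.sqrt x) =
        2 ^ (l - 1) * Real.Gamma ((l + ν + 1) / 2) * Real.Gamma ((l - ν + 1) / 2) := by
  obtain ⟨hi, hv⟩ := integrableOn_rpow_mul_besselK h1 h2
  have hp : (1 / 2 : ℝ) ≠ 0 := by norm_num
  have heq : EqOn (fun x : ℝ => (|(1 / 2 : ℝ)| * x ^ ((1 / 2 : ℝ) - 1)) •
      ((x ^ (1 / 2 : ℝ)) ^ l * besselK ν (x ^ (1 / 2 : ℝ))))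
      (fun x : ℝ => 1 / 2 * x ^ ((l - 1) / 2) * besselK ν (Real.sqrt x)) (Ioi 0) := by
    intro x hx
    have hx0 : 0 < x := hx
    simp only
    rw [smul_eq_mul, Real.sqrt_eq_rpow, abs_of_pos one_half_pos, ← Real.rpow_mul hx0.le,
      show (l - 1) / 2 = (1 / 2 - 1) + 1 / 2 * l by ring, Real.rpow_add hx0]
    ring
  rw [← integrableOn_Ioi_comp_rpow_iff _ hp] at hi
  rw [← integral_comp_rpow_Ioi _ hp, setIntegral_congr_fun measurableSet_Ioi heq] at hv
  exact ⟨hi.congr_fun heq measurableSet_Ioi, hv⟩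

lemma besselJ_eq (ν : ℝ) {x : ℝ} (hx : 0 < x) : besselJ ν x = x ^ ν * besselPhi ν x := by
  have hc : (x / 2) ^ ν = x ^ ν * 2 ^ (-ν) := by
    rw [Real.div_rpow hx.le two_pos.le, Real.rpow_neg two_pos.le, div_eq_mul_inv]
  unfold besselJ besselPhi hypF
  rw [← mul_assoc, ← hc, ← tsum_mul_left]
  refine tsum_congr fun k => ?_
  rw [Real.rpow_add (by positivity), show (2 * k : ℝ) = ((2 * k : ℕ) : ℝ) by push_cast; rfl,
    Real.rpow_natCast, pow_mul, neg_pow ((x / 2) ^ 2), hypCoeff, div_eq_mul_inv]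
  ring

lemma HasAbelLimit.add {f g : ℝ → ℂ} {L M : ℂ} (hf : HasAbelLimit f L) (hg : HasAbelLimit g M) :
    HasAbelLimit (fun x => f x + g x) (L + M) := by
  refine ⟨fun s hs => ?_, (hf.2.add hg.2).congr' ?_⟩
  · simp only [mul_add]
    exact (hf.1 s hs).add (hg.1 s hs)
  · filter_upwards [self_mem_nhdsWithin] with s hs
    simp only [mul_add]
    rw [integral_add (hf.1 s hs) (hg.1 s hs)]

lemma HasAbelLimit.const_mul {f : ℝ → ℂ} {L : ℂ} (hf : HasAbelLimit f L) (a : ℂ) :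
    HasAbelLimit (fun x => a * f x) (a * L) := by
  have h : ∀ s x : ℝ, Complex.exp (-(s : ℂ) * (x : ℂ)) * (a * f x) =
      a * (Complex.exp (-(s : ℂ) * (x : ℂ)) * f x) := fun s x => by ring
  refine ⟨fun s hs => ?_, ?_⟩
  · simp only [h]
    exact (hf.1 s hs).const_mul a
  · simpa only [h, integral_const_mul] using hf.2.const_mul a

lemma hasAbelLimit_pow_mul_besselJ {ν : ℝ} {m : ℕ} (j : ℕ) (h : -1 < 2 * ν + (2 * m + j : ℕ)) :
    HasAbelLimit
      (fun x : ℝ => (x : ℂ) ^ j * ((x ^ (ν + 2 * m) : ℝ) : ℂ) * ((besselJ ν x : ℝ) : ℂ))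
      ((if Even j then (-1) ^ (m + j / 2) / Real.pi * 2 ^ (ν + 2 * m + j) *
        Real.Gamma ((2 * ν + 2 * m + j + 1) / 2) * Real.Gamma ((2 * m + j + 1) / 2)
        else 0 : ℝ) : ℂ) := by
  have heq : ∀ s : ℝ, EqOn
      (fun x : ℝ => ((x ^ (2 * ν + (2 * m + j : ℕ)) * Real.exp (-(s * x)) * besselPhi ν x : ℝ) : ℂ))
      (fun x : ℝ => Complex.exp (-(s : ℂ) * (x : ℂ)) *
        ((x : ℂ) ^ j * ((x ^ (ν + 2 * m) : ℝ) : ℂ) * ((besselJ ν x : ℝ) : ℂ))) (Ioi 0) := by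
    intro s x hx
    have hx0 : 0 < x := hx
    have hpow : x ^ (2 * ν + (2 * m + j : ℕ)) = x ^ j * x ^ (ν + 2 * m) * x ^ ν := by
      rw [← Real.rpow_natCast x j, ← Real.rpow_add hx0, ← Real.rpow_add hx0]
      congr 1
      push_cast
      ring
    simp only
    rw [besselJ_eq ν hx0, hpow, show -(s : ℂ) * (x : ℂ) = ((-(s * x) : ℝ) : ℂ) by push_cast; ring,
      ← Complex.ofReal_exp]
    push_cast
    ring
  refine ⟨fun s hs => ?_, ?_⟩
  · exact IntegrableOn.congr_fun (integrableOn_rpow_exp_besselPhi ν h hs).ofReal (heq s)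
      measurableSet_Ioi
  · have hlim := (Complex.continuous_ofReal.tendsto _).comp (tendsto_laplacePhi (2 * m + j) ν h)
    have hval : (if Even (2 * m + j) then (-1) ^ ((2 * m + j) / 2) / Real.pi *
          2 ^ (ν + (2 * m + j : ℕ)) * Real.Gamma (ν + (2 * m + j : ℕ) / 2 + 1 / 2) *
          Real.Gamma ((2 * m + j : ℕ) / 2 + 1 / 2) else 0 : ℝ) =
        if Even j then (-1) ^ (m + j / 2) / Real.pi * 2 ^ (ν + 2 * m + j) *
          Real.Gamma ((2 * ν + 2 * m + j + 1) / 2) * Real.Gamma ((2 * m + j + 1) / 2)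
        else 0 := by
      have he : Even (2 * m + j) ↔ Even j := by simp [Nat.even_add]
      have hd : (2 * m + j) / 2 = m + j / 2 := by lia
      simp only [he, hd]
      push_cast
      congr 1
      congr 1
      · congr 2
        · ring_nf
        · ring
      · congr 1
        ring
    rw [hval] at hlim
    refine hlim.congr fun s => ?_
    rw [← setIntegral_congr_fun measurableSet_Ioi (heq s), integral_complex_ofReal]
    rfl

lemma I_mul_pow_add_neg_pow (j : ℕ) (y : ℂ) :
    (Complex.I * y) ^ j + (-(Complex.I * y)) ^ j =
      if Even j then 2 * (-1) ^ (j / 2) * y ^ j else 0 := by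
  split_ifs with hj
  · rw [hj.neg_pow, mul_pow]
    obtain ⟨n, rfl⟩ := hj
    rw [← two_mul n, pow_mul Complex.I, Complex.I_sq, Nat.mul_div_cancel_left n two_pos]
    ring
  · rw [(Nat.not_even_iff_odd.mp hj).neg_pow, add_neg_cancel]

lemma integrableOn_pow_mul_weightW {ν : ℝ} {m : ℕ} (j : ℕ) (h : -1 < 2 * ν + 2 * m) :
    IntegrableOn (fun x : ℝ =>
        ((Complex.I * (Real.sqrt x : ℂ)) ^ j + (-(Complex.I * (Real.sqrt x : ℂ))) ^ j) *
          ((weightW (ν + 2 * m) ν x : ℝ) : ℂ)) (Ioi 0) ∧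
      ∫ x in Ioi (0 : ℝ),
        ((Complex.I * (Real.sqrt x : ℂ)) ^ j + (-(Complex.I * (Real.sqrt x : ℂ))) ^ j) *
          ((weightW (ν + 2 * m) ν x : ℝ) : ℂ) =
        ((if Even j then (-1) ^ (j / 2) * 2 ^ (ν + 2 * m + j) *
          Real.Gamma ((2 * ν + 2 * m + j + 1) / 2) * Real.Gamma ((2 * m + j + 1) / 2)
          else 0 : ℝ) : ℂ) := by
  have hj0 : (0 : ℝ) ≤ j := j.cast_nonneg
  have hm0 : (0 : ℝ) ≤ m := m.cast_nonneg
  obtain ⟨hi, hv⟩ := integrableOn_rpow_mul_besselK_sqrt (l := ν + 2 * m + j) (ν := ν)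
    (by linarith) (by linarith)
  have heq : EqOn (fun x : ℝ => (((if Even j then 2 * (-1) ^ (j / 2) else 0 : ℝ) *
        (1 / 2 * x ^ ((ν + 2 * m + j - 1) / 2) * besselK ν (Real.sqrt x)) : ℝ) : ℂ))
      (fun x : ℝ =>
        ((Complex.I * (Real.sqrt x : ℂ)) ^ j + (-(Complex.I * (Real.sqrt x : ℂ))) ^ j) *
          ((weightW (ν + 2 * m) ν x : ℝ) : ℂ)) (Ioi 0) := by
    intro x hx
    have hx0 : 0 < x := hx
    have hpow : x ^ ((ν + 2 * m + j - 1) / 2) = Real.sqrt x ^ j * x ^ ((ν + 2 * m - 1) / 2) := by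
      rw [Real.sqrt_eq_rpow, ← Real.rpow_mul_natCast hx0.le, ← Real.rpow_add hx0]
      congr 1
      ring
    simp only
    have hw : weightW (ν + 2 * m) ν x =
        1 / 2 * x ^ ((ν + 2 * m - 1) / 2) * besselK ν (Real.sqrt x) :=
      if_pos ⟨(m : ℤ), by push_cast; ring⟩
    rw [I_mul_pow_add_neg_pow, hpow, hw]
    split_ifs <;> push_cast <;> ring
  have hi' := (hi.const_mul (if Even j then 2 * (-1) ^ (j / 2) else 0 : ℝ)).ofReal (𝕜 := ℂ)
  refine ⟨IntegrableOn.congr_fun hi' heq measurableSet_Ioi, ?_⟩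
  rw [← setIntegral_congr_fun measurableSet_Ioi heq, integral_complex_ofReal, integral_const_mul,
    hv]
  congr 1
  split_ifs
  · rw [Real.rpow_sub_one two_ne_zero, show ν + 2 * m + j + ν = 2 * ν + 2 * m + j by ring,
      show ν + 2 * m + j - ν = 2 * m + (j : ℝ) by ring]
    ring
  · ring

/-- Abel limit of `∫₀^∞ Ψ(x) x^μ J_ν(x) dx` for polynomials `Ψ`, `μ − ν` even. -/
theorem abel_limit_poly_besselJ (μ ν : ℝ) (h1 : -1 < μ + ν)
    (heven : ∃ m : ℕ, μ - ν = 2 * m) (Ψ : Polynomial ℂ) :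
    HasAbelLimit
      (fun x : ℝ => Ψ.eval (x : ℂ) * ((x ^ μ : ℝ) : ℂ) * ((besselJ ν x : ℝ) : ℂ))
      (Complex.exp (Complex.I * ((μ : ℂ) - (ν : ℂ)) * (Real.pi : ℂ) / 2) / (Real.pi : ℂ) *
        ∫ x in Set.Ioi (0:ℝ),
          (Ψ.eval (Complex.I * (Real.sqrt x : ℂ)) + Ψ.eval (-(Complex.I * (Real.sqrt x : ℂ)))) *
            ((weightW μ ν x : ℝ) : ℂ)) := by
  obtain ⟨m, hm⟩ := heven
  obtain rfl : μ = ν + 2 * m := by linarith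
  have h : -1 < 2 * ν + 2 * m := by linarith
  suffices H : IntegrableOn (fun x : ℝ =>
        (Ψ.eval (Complex.I * (Real.sqrt x : ℂ)) + Ψ.eval (-(Complex.I * (Real.sqrt x : ℂ)))) *
          ((weightW (ν + 2 * m) ν x : ℝ) : ℂ)) (Ioi 0) ∧
      HasAbelLimit
        (fun x : ℝ => Ψ.eval (x : ℂ) * ((x ^ (ν + 2 * m) : ℝ) : ℂ) * ((besselJ ν x : ℝ) : ℂ))
        ((-1) ^ m / (Real.pi : ℂ) * ∫ x in Ioi (0 : ℝ),
          (Ψ.eval (Complex.I * (Real.sqrt x : ℂ)) + Ψ.eval (-(Complex.I * (Real.sqrt x : ℂ)))) *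
            ((weightW (ν + 2 * m) ν x : ℝ) : ℂ)) by
    have hexp : Complex.exp (Complex.I * (((ν + 2 * m : ℝ) : ℂ) - (ν : ℂ)) * (Real.pi : ℂ) / 2) =
        (-1) ^ m := by
      rw [← Complex.exp_pi_mul_I, ← Complex.exp_nat_mul]
      congr 1
      push_cast
      ring
    rw [hexp]
    exact H.2
  induction Ψ using Polynomial.induction_on' with
  | add P Q hP hQ =>
    have hsplit : ∀ x : ℝ,
        ((P + Q).eval (Complex.I * (Real.sqrt x : ℂ)) +
          (P + Q).eval (-(Complex.I * (Real.sqrt x : ℂ)))) * ((weightW (ν + 2 * m) ν x : ℝ) : ℂ) =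
        (P.eval (Complex.I * (Real.sqrt x : ℂ)) + P.eval (-(Complex.I * (Real.sqrt x : ℂ)))) *
          ((weightW (ν + 2 * m) ν x : ℝ) : ℂ) +
        (Q.eval (Complex.I * (Real.sqrt x : ℂ)) + Q.eval (-(Complex.I * (Real.sqrt x : ℂ)))) *
          ((weightW (ν + 2 * m) ν x : ℝ) : ℂ) := fun x => by
      simp only [eval_add]
      ring
    simp only [hsplit]
    refine ⟨hP.1.add hQ.1, ?_⟩
    rw [integral_add hP.1 hQ.1, mul_add]
    simpa only [eval_add, add_mul] using hP.2.add hQ.2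
  | monomial j a =>
    have hsplit : ∀ x : ℝ,
        ((monomial j a).eval (Complex.I * (Real.sqrt x : ℂ)) +
          (monomial j a).eval (-(Complex.I * (Real.sqrt x : ℂ)))) *
            ((weightW (ν + 2 * m) ν x : ℝ) : ℂ) =
        a * (((Complex.I * (Real.sqrt x : ℂ)) ^ j + (-(Complex.I * (Real.sqrt x : ℂ))) ^ j) *
          ((weightW (ν + 2 * m) ν x : ℝ) : ℂ)) := fun x => by
      simp only [eval_monomial]
      ring
    simp only [hsplit]
    obtain ⟨hi, hv⟩ := integrableOn_pow_mul_weightW j h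
    refine ⟨hi.const_mul a, ?_⟩
    have hp : -1 < 2 * ν + (2 * m + j : ℕ) := by
      have hj0 : (0 : ℝ) ≤ j := j.cast_nonneg
      push_cast
      linarith
    have hlim := (hasAbelLimit_pow_mul_besselJ j hp).const_mul a
    rw [integral_const_mul, hv]
    simp only [eval_monomial, mul_assoc] at hlim ⊢
    convert hlim using 1
    rw [mul_left_comm]
    congr 1
    split_ifs
    · push_cast
      ring
    · simp

end
end
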